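/- arXiv:1811.10849 — 4 statements merged into one kernel-verified Lean document; each statement's English description precedes it below -/
import Mathlib

section
/- Let Γ be a group with finite generating set S and word metric d_w(x,y) = ‖x⁻¹y‖_S. Let μ be an admissible probability measure on Γ whose Green function G(x,y) = ∑_{n≥0} μ^{*n}(x⁻¹y) is finite for all x, y, and let d_G(x,y) = −log G(x,y) + log G(e,e) be the Green distance. Assume there exist v > 0 and C ≥ 0 such that |d_G(e,g) − v·‖g‖_S| ≤ C for all g ∈ Γ. Then there exists N ∈ ℕ such that for all x, y ∈ Γ, the set of midpoints of word geodesics from x to y, namely {w ∈ Γ : d_w(x,w) + d_w(w,y) = d_w(x,y) and d_w(x,w) = ⌊d_w(x,y)/2⌋}, has at most N elements. -/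
open scoped ENNReal
open Filter
open scoped Classical

/-- The word length of `g` with respect to a generating set `S`:
the least `n` such that `g` is a product of `n` elements of `S ∪ S⁻¹`. -/
noncomputable def wordLength {G : Type*} [Group G] (S : Set G) (g : G) : ℕ :=
  sInf {n | ∃ l : List G, l.length = n ∧ (∀ x ∈ l, x ∈ S ∨ x⁻¹ ∈ S) ∧ l.prod = g}

/-- Convolution of two measures (given as `ℝ≥0∞`-valued functions) on a group. -/
noncomputable def conv {G : Type*} [Group G] (μ ν : G → ℝ≥0∞) : G → ℝ≥0∞ :=
  fun g => ∑' h, μ h * ν (h⁻¹ * g)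

/-- `n`-fold convolution power, with `μ^{*0}` the point mass at the identity. -/
noncomputable def convPow {G : Type*} [Group G] (μ : G → ℝ≥0∞) : ℕ → G → ℝ≥0∞
  | 0 => fun g => if g = 1 then 1 else 0
  | n + 1 => conv (convPow μ n) μ

/-- The entropy `H(μ) = -∑ μ(g) log μ(g)`, valued in `[0,∞]`. -/
noncomputable def entropy {G : Type*} (μ : G → ℝ≥0∞) : ℝ≥0∞ :=
  ∑' g, ENNReal.ofReal (-(μ g).toReal * Real.log (μ g).toReal)

/-- The Green function `G(x,y) = ∑_{n ≥ 0} μ^{*n}(x⁻¹ y)` of the random walk. -/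
noncomputable def greenFn {G : Type*} [Group G] (μ : G → ℝ≥0∞) (x y : G) : ℝ≥0∞ :=
  ∑' n : ℕ, convPow μ n (x⁻¹ * y)

lemma conv_translate {G : Type*} [Group G] (f μ : G → ℝ≥0∞) (w z : G) :
    ∑' h, f (w⁻¹ * h) * μ (h⁻¹ * z) = conv f μ (w⁻¹ * z) := by
  unfold conv
  rw [← (Equiv.mulLeft w).tsum_eq]
  simp [mul_assoc]

lemma green_super {G : Type*} [Group G] (μ : G → ℝ≥0∞) (z : G) :
    ∑' h, (∑' n : ℕ, convPow μ n h) * μ (h⁻¹ * z) ≤ ∑' n : ℕ, convPow μ n z := by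
  have : ∑' h, (∑' n : ℕ, convPow μ n h) * μ (h⁻¹ * z) = ∑' n : ℕ, convPow μ (n+1) z := by
    simp_rw [← ENNReal.tsum_mul_right]
    rw [ENNReal.tsum_comm]
    rfl
  rw [this]
  exact ENNReal.tsum_comp_le_tsum_of_injective (add_left_injective 1) (fun n => convPow μ n z)

/-- Domination principle. -/
lemma green_dom {G : Type*} [Group G] (μ : G → ℝ≥0∞) (W : Finset G) (b : G → ℝ≥0∞)
    (H : ∀ z ∈ W, ∑ w ∈ W, b w * (∑' n : ℕ, convPow μ n (w⁻¹ * z)) ≤ ∑' n : ℕ, convPow μ n z)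
    (z : G) :
    ∑ w ∈ W, b w * (∑' n : ℕ, convPow μ n (w⁻¹ * z)) ≤ ∑' n : ℕ, convPow μ n z := by
  have key : ∀ n : ℕ, ∀ z, ∑ w ∈ W, b w * (∑ k ∈ Finset.range n, convPow μ k (w⁻¹ * z))
      ≤ ∑' n : ℕ, convPow μ n z := by
    intro n
    induction n with
    | zero => intro z; simp
    | succ n ih =>
      intro z
      by_cases hz : z ∈ W
      · refine le_trans ?_ (H z hz)
        gcongr
        exact ENNReal.sum_le_tsum _
      · have e : ∑ w ∈ W, b w * (∑ k ∈ Finset.range (n+1), convPow μ k (w⁻¹ * z))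
            = ∑' h, (∑ w ∈ W, b w * (∑ k ∈ Finset.range n, convPow μ k (w⁻¹ * h)))
                * μ (h⁻¹ * z) := by
          simp_rw [Finset.sum_mul, mul_assoc, Finset.sum_mul]
          rw [Summable.tsum_finsetSum (fun _ _ => ENNReal.summable)]
          refine Finset.sum_congr rfl fun w hw => ?_
          rw [ENNReal.tsum_mul_left, Summable.tsum_finsetSum (fun _ _ => ENNReal.summable)]
          congr 1
          rw [Finset.sum_range_succ']
          have h0 : convPow μ 0 (w⁻¹ * z) = 0 := by
            have : w⁻¹ * z ≠ 1 := by
              intro h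
              rw [inv_mul_eq_one] at h
              exact hz (h ▸ hw)
            simp [convPow, this]
          rw [h0, add_zero]
          refine Finset.sum_congr rfl fun k _ => ?_
          exact (conv_translate (convPow μ k) μ w z).symm
        rw [e]
        refine le_trans ?_ (green_super μ z)
        gcongr with h
        exact ih h
  refine le_of_tendsto' (f := fun n : ℕ => ∑ w ∈ W, b w *
    (∑ k ∈ Finset.range n, convPow μ k (w⁻¹ * z))) (x := atTop) ?_ (fun n => key n z)
  have e : ∀ w, Monotone fun n => b w * ∑ k ∈ Finset.range n, convPow μ k (w⁻¹ * z) := by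
    intro w m n hmn
    dsimp only
    gcongr
  have e2 : ∀ w, b w * (∑' n : ℕ, convPow μ n (w⁻¹ * z)) =
      ⨆ n, b w * ∑ k ∈ Finset.range n, convPow μ k (w⁻¹ * z) := by
    intro w
    rw [ENNReal.tsum_eq_iSup_nat, ENNReal.mul_iSup]
  refine tendsto_finsetSum _ fun w _ => ?_
  rw [e2]
  exact tendsto_atTop_iSup (e w)

lemma green_dom_real {G : Type*} [Group G] (μ : G → ℝ≥0∞) (r : G → ℝ)
    (hr : ∀ z, ∑' n : ℕ, convPow μ n z = ENNReal.ofReal (r z)) (hr0 : ∀ z, 0 ≤ r z)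
    (W : Finset G) (b : G → ℝ) (hb : ∀ z, 0 ≤ b z)
    (H : ∀ z ∈ W, ∑ w ∈ W, b w * r (w⁻¹ * z) ≤ r z) (z : G) :
    ∑ w ∈ W, b w * r (w⁻¹ * z) ≤ r z := by
  have e : ∀ z, ∑ w ∈ W, ENNReal.ofReal (b w) * (∑' n : ℕ, convPow μ n (w⁻¹ * z)) =
      ENNReal.ofReal (∑ w ∈ W, b w * r (w⁻¹ * z)) := by
    intro z
    rw [ENNReal.ofReal_sum_of_nonneg (fun w _ => mul_nonneg (hb w) (hr0 _))]
    refine Finset.sum_congr rfl fun w _ => ?_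
    rw [hr, ENNReal.ofReal_mul (hb w)]
  have := green_dom μ W (fun w => ENNReal.ofReal (b w)) (by
    intro z hz
    rw [e, hr]
    exact ENNReal.ofReal_le_ofReal (H z hz)) z
  rw [e, hr] at this
  exact (ENNReal.ofReal_le_ofReal_iff (hr0 z)).1 this

lemma words_finite {G : Type*} [Group G] (S : Set G) (hS : S.Finite) (n : ℕ) :
    {g : G | ∃ l : List G, l.length = n ∧ (∀ x ∈ l, x ∈ S ∨ x⁻¹ ∈ S) ∧ l.prod = g}.Finite := by
  induction n with
  | zero =>
    refine (Set.finite_singleton (1 : G)).subset ?_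
    rintro g ⟨l, hl, -, rfl⟩
    simp [List.length_eq_zero_iff.1 hl]
  | succ n ih =>
    have hT : {x : G | x ∈ S ∨ x⁻¹ ∈ S}.Finite := by
      refine (hS.union (hS.image (fun x => x⁻¹))).subset ?_
      rintro x (hx | hx)
      · exact Or.inl hx
      · exact Or.inr ⟨_, hx, by simp⟩
    refine (hT.image2 (fun a b => a * b) ih).subset ?_
    rintro g ⟨l, hl, hm, rfl⟩
    cases l with
    | nil => simp at hl
    | cons a l =>
      refine ⟨a, hm a (by simp), l.prod, ⟨l, by simpa using hl, fun x hx => hm x (by simp [hx]), rfl⟩,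
        by simp⟩

lemma exists_word {G : Type*} [Group G] (S : Set G) (hgen : Subgroup.closure S = ⊤) (g : G) :
    ∃ l : List G, l.length = wordLength S g ∧ (∀ x ∈ l, x ∈ S ∨ x⁻¹ ∈ S) ∧ l.prod = g := by
  have hne : {n | ∃ l : List G, l.length = n ∧ (∀ x ∈ l, x ∈ S ∨ x⁻¹ ∈ S) ∧ l.prod = g}.Nonempty := by
    have hg : g ∈ (Subgroup.closure S).toSubmonoid := by simp [hgen]
    rw [Subgroup.closure_toSubmonoid] at hg
    obtain ⟨l, h1, h2⟩ := Submonoid.exists_list_of_mem_closure hg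
    exact ⟨l.length, l, rfl, fun x hx => by simpa using h1 x hx, h2⟩
  exact Nat.sInf_mem hne

lemma ball_finite {G : Type*} [Group G] (S : Set G) (hS : S.Finite)
    (hgen : Subgroup.closure S = ⊤) (R : ℕ) : {g : G | wordLength S g < R}.Finite := by
  refine ((Set.finite_lt_nat R).biUnion (fun n _ => words_finite S hS n)).subset ?_
  intro g hg
  exact Set.mem_biUnion hg (exists_word S hgen g)

lemma sep_or_cover {G : Type*} [Group G] (D : Finset G) (h1 : 1 ∈ D) (hinv : ∀ g ∈ D, g⁻¹ ∈ D)
    (M : Set G) (K : ℕ) :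
    (∃ W : Finset G, ↑W ⊆ M ∧ W.card = K ∧ ∀ w ∈ W, ∀ z ∈ W, w ≠ z → w⁻¹ * z ∉ D) ∨
    (M.ncard ≤ K * D.card) := by
  induction K with
  | zero => exact Or.inl ⟨∅, by simp⟩
  | succ K ih =>
    rcases ih with ⟨W, hWM, hc, hs⟩ | h
    · by_cases hM : M ⊆ ↑(Finset.image₂ (fun a b => a * b) W D)
      · right
        calc M.ncard ≤ (Finset.image₂ (fun a b => a * b) W D : Set G).ncard :=
              Set.ncard_le_ncard hM (Finset.finite_toSet _)
          _ ≤ W.card * D.card := by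
              rw [Set.ncard_coe_finset]; exact Finset.card_image₂_le _ _ _
          _ ≤ _ := by rw [hc]; gcongr; omega
      · left
        obtain ⟨z, hzM, hz⟩ := Set.not_subset.1 hM
        have hz' : ∀ w ∈ W, w⁻¹ * z ∉ D := by
          intro w hw hd
          exact hz (Finset.mem_coe.2 (Finset.mem_image₂.2 ⟨w, hw, _, hd, by simp⟩))
        have hzW : z ∉ W := fun h => hz' z h (by simpa using h1)
        refine ⟨insert z W, ?_, by rw [Finset.card_insert_of_notMem hzW, hc], ?_⟩
        · rw [Finset.coe_insert]; exact Set.insert_subset hzM hWM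
        · intro a ha c hcc hne
          rcases Finset.mem_insert.1 ha with rfl | ha
          · rcases Finset.mem_insert.1 hcc with rfl | hcc
            · exact absurd rfl hne
            · intro hd
              have := hinv _ hd
              simp only [mul_inv_rev, inv_inv] at this
              exact hz' c hcc this
          · rcases Finset.mem_insert.1 hcc with rfl | hcc
            · exact hz' a (by assumption)
            · exact hs a ha c hcc hne
    · right
      exact h.trans (by gcongr; omega)

lemma sep_card_lt {G : Type*} [Group G] (S : Set G) (μ : G → ℝ≥0∞) (r : G → ℝ)
    (hr : ∀ z, ∑' n : ℕ, convPow μ n z = ENNReal.ofReal (r z)) (hr0 : ∀ z, 0 ≤ r z)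
    (a A v : ℝ) (ha : 0 < a) (hA : 0 < A) (hv : 0 < v)
    (hlo : ∀ z, a * Real.exp (-(v * wordLength S z)) ≤ r z)
    (hup : ∀ z, r z ≤ A * Real.exp (-(v * wordLength S z)))
    (K R : ℕ) (hK : A * (r 1 + 1) / a ^ 2 < K)
    (hR : K * (A ^ 2 / a) * Real.exp (-(v * R)) ≤ 1)
    (y : G) (k m : ℕ) (hkm : k + m = wordLength S y) (W : Finset G)
    (hWk : ∀ w ∈ W, wordLength S w = k) (hWm : ∀ w ∈ W, wordLength S (w⁻¹ * y) = m)
    (hsep : ∀ w ∈ W, ∀ z ∈ W, w ≠ z → R ≤ wordLength S (w⁻¹ * z)) (hc : W.card = K) : False := by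
  have hL : 0 < r 1 + 1 := by linarith [hr0 1]
  have h := green_dom_real μ r hr hr0 W (fun w => r w / (r 1 + 1))
    (fun z => div_nonneg (hr0 z) hL.le) (by
      intro z hz
      have hterm : ∀ w ∈ W.erase z, r w / (r 1 + 1) * r (w⁻¹ * z) ≤
          (A ^ 2 / a) * Real.exp (-(v * R)) * r z / (r 1 + 1) := by
        intro w hw
        have hwW := Finset.mem_of_mem_erase hw
        have h1 : r w ≤ A / a * r z := by
          have := hup w
          have h2 := hlo z
          rw [hWk w hwW] at this
          rw [hWk z hz] at h2
          calc r w ≤ A * Real.exp (-(v * k)) := this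
            _ = A / a * (a * Real.exp (-(v * k))) := by field_simp
            _ ≤ _ := by gcongr
        have h2 : r (w⁻¹ * z) ≤ A * Real.exp (-(v * R)) := by
          refine (hup _).trans ?_
          have := hsep w hwW z hz (Finset.ne_of_mem_erase hw)
          gcongr
        calc r w / (r 1 + 1) * r (w⁻¹ * z) ≤ (A / a * r z) / (r 1 + 1) * (A * Real.exp (-(v * R))) := by
              have := hr0 z
              have := hr0 (w⁻¹ * z)
              gcongr
          _ = _ := by field_simp
      rw [← Finset.add_sum_erase W _ hz]
      have hsum := Finset.sum_le_card_nsmul _ _ _ hterm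
      have hcard : ((W.erase z).card : ℝ) ≤ K := by
        rw [← hc]; exact_mod_cast Finset.card_erase_le
      rw [nsmul_eq_mul] at hsum
      have h3 : ((W.erase z).card : ℝ) * ((A ^ 2 / a) * Real.exp (-(v * R)) * r z / (r 1 + 1)) ≤
          r z / (r 1 + 1) := by
        have := hr0 z
        calc _ ≤ (K : ℝ) * ((A ^ 2 / a) * Real.exp (-(v * R)) * r z / (r 1 + 1)) := by gcongr
          _ = (K * (A ^ 2 / a) * Real.exp (-(v * R))) * (r z / (r 1 + 1)) := by ring
          _ ≤ 1 * (r z / (r 1 + 1)) := by gcongr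
          _ = _ := one_mul _
      have h4 : r z / (r 1 + 1) * r (z⁻¹ * z) + r z / (r 1 + 1) = r z := by
        rw [inv_mul_cancel]; field_simp
      linarith) y
  have hlow : ∀ w ∈ W, a ^ 2 * Real.exp (-(v * wordLength S y)) / (r 1 + 1) ≤
      r w / (r 1 + 1) * r (w⁻¹ * y) := by
    intro w hw
    have h1 := hlo w
    have h2 := hlo (w⁻¹ * y)
    rw [hWk w hw] at h1
    rw [hWm w hw] at h2
    have h0 := hr0 w
    calc _ = (a * Real.exp (-(v * k))) / (r 1 + 1) * (a * Real.exp (-(v * m))) := by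
          rw [← hkm]; push_cast
          rw [mul_add, neg_add, Real.exp_add]; ring
      _ ≤ _ := by gcongr
  have hs := Finset.card_nsmul_le_sum _ _ _ hlow
  rw [nsmul_eq_mul, hc] at hs
  have h5 := (hs.trans h).trans (hup y)
  have hE := Real.exp_pos (-(v * wordLength S y))
  have h6 : (K : ℝ) * a ^ 2 / (r 1 + 1) ≤ A := by
    refine le_of_mul_le_mul_right ?_ hE
    calc _ = _ := by ring
      _ ≤ _ := h5
  rw [div_le_iff₀ hL] at h6
  rw [div_lt_iff₀ (by positivity)] at hK
  linarith

/-- If the Green metric is roughly similar to the word metric (`|d_G - v·d_w| ≤ C`),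
then the number of midpoints of word geodesics between any two points `x, y`
is uniformly bounded. -/
theorem midpoints_uniformly_bounded_of_green_roughly_similar
    {Γ : Type*} [Group Γ] (S : Set Γ) (hSfin : S.Finite)
    (hSgen : Subgroup.closure S = ⊤)
    (μ : Γ → ℝ≥0∞) (hprob : ∑' g, μ g = 1)
    (hadm : ∀ g : Γ, ∃ n : ℕ, 0 < convPow μ n g)
    (hGfin : ∀ x y : Γ, greenFn μ x y ≠ ∞)
    (dG : Γ → Γ → ℝ)
    (hdG : ∀ x y : Γ,
      dG x y = - Real.log (greenFn μ x y).toReal + Real.log (greenFn μ 1 1).toReal)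
    (v C : ℝ) (hv : 0 < v) (hC : 0 ≤ C)
    (hsim : ∀ g : Γ, |dG 1 g - v * (wordLength S g : ℝ)| ≤ C) :
    ∃ N : ℕ, ∀ x y : Γ,
      {w : Γ | wordLength S (x⁻¹ * w) + wordLength S (w⁻¹ * y) = wordLength S (x⁻¹ * y) ∧
        wordLength S (x⁻¹ * w) = wordLength S (x⁻¹ * y) / 2}.ncard ≤ N := by
  set r : Γ → ℝ := fun z => (∑' n : ℕ, convPow μ n z).toReal with hrdef
  have hgr : ∀ z, greenFn μ 1 z = ∑' n : ℕ, convPow μ n z := fun z => by simp [greenFn]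
  have hfin : ∀ z, ∑' n : ℕ, convPow μ n z ≠ ∞ := fun z => hgr z ▸ hGfin 1 z
  have hr : ∀ z, ∑' n : ℕ, convPow μ n z = ENNReal.ofReal (r z) := fun z =>
    (ENNReal.ofReal_toReal (hfin z)).symm
  have hpos : ∀ z, 0 < r z := by
    intro z
    obtain ⟨n, hn⟩ := hadm z
    exact ENNReal.toReal_pos (hn.trans_le (ENNReal.le_tsum n)).ne' (hfin z)
  have hb : ∀ z, |-Real.log (r z) + Real.log (r 1) - v * wordLength S z| ≤ C := by
    intro z
    have := hsim z
    rwa [hdG, hgr, hgr] at this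
  have hlo : ∀ z, (r 1 * Real.exp (-C)) * Real.exp (-(v * wordLength S z)) ≤ r z := by
    intro z
    have := (abs_le.1 (hb z)).2
    rw [← Real.exp_log (hpos z)]
    nth_rw 1 [← Real.exp_log (hpos 1)]
    rw [← Real.exp_add, ← Real.exp_add]
    apply Real.exp_le_exp.2
    linarith
  have hup : ∀ z, r z ≤ (r 1 * Real.exp C) * Real.exp (-(v * wordLength S z)) := by
    intro z
    have := (abs_le.1 (hb z)).1
    rw [← Real.exp_log (hpos z)]
    nth_rw 1 [← Real.exp_log (hpos 1)]
    rw [← Real.exp_add, ← Real.exp_add]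
    apply Real.exp_le_exp.2
    linarith
  have ha : 0 < r 1 * Real.exp (-C) := mul_pos (hpos 1) (Real.exp_pos _)
  have hA : 0 < r 1 * Real.exp C := mul_pos (hpos 1) (Real.exp_pos _)
  generalize r 1 * Real.exp (-C) = a at *
  generalize r 1 * Real.exp C = A at *
  obtain ⟨K, hK⟩ := exists_nat_gt (A * (r 1 + 1) / a ^ 2)
  obtain ⟨R, hR⟩ : ∃ R : ℕ, K * (A ^ 2 / a) * Real.exp (-(v * R)) ≤ 1 := by
    have ht : Tendsto (fun R : ℕ => K * (A ^ 2 / a) * Real.exp (-(v * R))) atTop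
        (nhds (K * (A ^ 2 / a) * 0)) := by
      refine Tendsto.const_mul _ (Real.tendsto_exp_neg_atTop_nhds_zero.comp ?_)
      exact tendsto_natCast_atTop_atTop.const_mul_atTop hv
    rw [mul_zero] at ht
    exact (ht.eventually_le_const one_pos).exists
  set B := (ball_finite S hSfin hSgen R).toFinset with hB
  set D := insert 1 (B ∪ B.image (fun g => g⁻¹)) with hD
  refine ⟨K * D.card, fun x y => ?_⟩
  set M := {w : Γ | wordLength S (x⁻¹ * w) + wordLength S (w⁻¹ * y) = wordLength S (x⁻¹ * y) ∧
        wordLength S (x⁻¹ * w) = wordLength S (x⁻¹ * y) / 2} with hM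
  rcases sep_or_cover D (by simp [hD]) (by
    intro g hg
    simp only [hD, Finset.mem_insert, Finset.mem_union, Finset.mem_image] at hg ⊢
    rcases hg with rfl | h | ⟨h, h1, rfl⟩
    · simp
    · exact Or.inr (Or.inr ⟨g, h, rfl⟩)
    · exact Or.inr (Or.inl (by simpa using h1))) M K with ⟨W, hWM, hc, hs⟩ | h
  · exfalso
    have hcard : (W.image (fun w => x⁻¹ * w)).card = K := by
      rw [Finset.card_image_of_injective _ (mul_right_injective _), hc]
    refine sep_card_lt S μ r hr (fun z => (hpos z).le) a A v ha hA hv hlo hup K R hK hR (x⁻¹ * y)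
      (wordLength S (x⁻¹ * y) / 2) (wordLength S (x⁻¹ * y) - wordLength S (x⁻¹ * y) / 2) (by omega)
      (W.image (fun w => x⁻¹ * w)) ?_ ?_ ?_ hcard
    · intro u hu
      obtain ⟨w, hw, rfl⟩ := Finset.mem_image.1 hu
      exact (hWM hw).2
    · intro u hu
      obtain ⟨w, hw, rfl⟩ := Finset.mem_image.1 hu
      have h1 := (hWM hw).1
      have h2 := (hWM hw).2
      have e : (x⁻¹ * w)⁻¹ * (x⁻¹ * y) = w⁻¹ * y := by group
      rw [e]
      omega
    · intro u hu u2 hu2 hne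
      obtain ⟨w, hw, rfl⟩ := Finset.mem_image.1 hu
      obtain ⟨w2, hw2, rfl⟩ := Finset.mem_image.1 hu2
      have e : (x⁻¹ * w)⁻¹ * (x⁻¹ * w2) = w⁻¹ * w2 := by group
      rw [e]
      have h1 := hs w hw w2 hw2 (fun h => hne (by rw [h]))
      by_contra hlt
      apply h1
      simp only [hD, Finset.mem_insert, Finset.mem_union]
      right; left
      simp only [hB, Set.Finite.mem_toFinset, Set.mem_ofPred_eq]
      omega
  · exact h
end

section
/- Let Z be a compact metrizable topological space with at least two points, and let a countable group G act on Z by homeomorphisms. Let ν₁, ν₂, κ₁, κ₂ be Borel probability measures on Z of full support, with ν_i equivalent (mutually absolutely continuous) to κ_i for i = 1, 2, and such that G preserves the measure class of each of ν₁, ν₂, κ₁, κ₂. Assume the diagonal G-action on Z×Z is ergodic with respect to ν₁⊗ν₂ and with respect to κ₁⊗κ₂ (every G-invariant Borel subset of Z×Z is null or conull). Suppose there exist Borel measurable functions f_ν, f_κ : (Z×Z)∖Diag → ℝ that are positive, bounded away from 0, and bounded on compact subsets of (Z×Z)∖Diag, such that the measures m_ν = f_ν·(ν₁⊗ν₂)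 and m_κ = f_κ·(κ₁⊗κ₂), restricted to (Z×Z)∖Diag, are G-invariant and ergodic (every G-invariant Borel subset of (Z×Z)∖Diag is either m-null or has m-null complement). Then for each i = 1, 2 there is a constant C ≥ 1 such that C⁻¹ ≤ dν_i/dκ_i ≤ C holds κ_i-almost everywhere. -/
open MeasureTheory

/-- Invariant measures dominated by an ergodic one are bounded by a multiple of it. -/
lemma aux_ergodic_le {X G : Type*} [MeasurableSpace X] [Group G] [Countable G] [MulAction G X]
    (hm : ∀ g : G, Measurable (fun x : X => g • x))
    (μ ν : Measure X) [SigmaFinite μ] [SigmaFinite ν] (hac : μ ≪ ν) (hν : ν ≠ 0)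
    (hinvμ : ∀ g : G, Measure.map (fun x : X => g • x) μ = μ)
    (hinvν : ∀ g : G, Measure.map (fun x : X => g • x) ν = ν)
    (herg : ∀ A : Set X, MeasurableSet A → (∀ g : G, (fun x : X => g • x) ⁻¹' A = A) →
      ν A = 0 ∨ ν Aᶜ = 0) :
    ∃ c : NNReal, μ ≤ c • ν := by
  have hconst : MeasurableConstSMul G X := ⟨hm⟩
  have hE : ErgodicSMul G X ν :=
    { measure_preimage_smul := fun g s hs => by
        conv_rhs => rw [← hinvν g, Measure.map_apply (hm g) hs]
      aeconst_of_forall_preimage_smul_ae_eq := by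
        intro s hs h
        rw [Filter.eventuallyConst_set]
        have hT : (⋂ g : G, (fun x : X => g • x) ⁻¹' s) =ᵐ[ν] s := by
          have hall : ∀ᵐ x ∂ν, ∀ g : G, (g • x ∈ s ↔ x ∈ s) := by
            rw [ae_all_iff]
            intro g
            filter_upwards [h g] with x hx
            exact iff_of_eq hx
          filter_upwards [hall] with x hx
          apply propext
          change x ∈ (⋂ g : G, (fun x : X => g • x) ⁻¹' s) ↔ x ∈ s
          rw [Set.mem_iInter]
          exact ⟨fun h1 => (hx 1).1 (h1 1), fun h1 g => (hx g).2 h1⟩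
        have hinvT : ∀ g' : G, (fun x : X => g' • x) ⁻¹' (⋂ g : G, (fun x : X => g • x) ⁻¹' s) =
            ⋂ g : G, (fun x : X => g • x) ⁻¹' s := by
          intro g'
          ext x
          simp only [Set.mem_preimage, Set.mem_iInter]
          constructor
          · intro h1 g
            simpa [smul_smul] using h1 (g * g'⁻¹)
          · intro h1 g
            simpa [smul_smul] using h1 (g * g')
        rcases herg _ (MeasurableSet.iInter fun g => hm g hs) hinvT with h0 | h0
        · right
          filter_upwards [measure_eq_zero_iff_ae_notMem.mp ((measure_congr hT).symm.trans h0)]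
            with x hx using by simpa using hx
        · left
          have h1 : ∀ᵐ x ∂ν, x ∈ (⋂ g : G, (fun x : X => g • x) ⁻¹' s) := h0
          filter_upwards [h1, hT] with x hx hx2
          exact (iff_of_eq hx2).1 hx }
  have hh : ∀ g : G, (fun x => μ.rnDeriv ν (g • x)) =ᵐ[ν] μ.rnDeriv ν := by
    intro g
    have := (MeasurableEquiv.smul g : X ≃ᵐ X).measurableEmbedding.rnDeriv_map μ ν
    have e1 : Measure.map (MeasurableEquiv.smul g : X ≃ᵐ X) μ = μ := hinvμ g
    have e2 : Measure.map (MeasurableEquiv.smul g : X ≃ᵐ X) ν = ν := hinvν g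
    rw [e1, e2] at this
    exact this
  have key : ∃ n : ℕ, ν {x | μ.rnDeriv ν x ≤ n} ≠ 0 := by
    by_contra! hcon
    apply hν
    rw [← Measure.measure_univ_eq_zero]
    have h1 : ν (⋃ n : ℕ, {x | μ.rnDeriv ν x ≤ n}) = 0 := measure_iUnion_null hcon
    have h2 : ∀ᵐ x ∂ν, x ∈ (⋃ n : ℕ, {x | μ.rnDeriv ν x ≤ n}) := by
      filter_upwards [Measure.rnDeriv_lt_top μ ν] with x hx
      obtain ⟨n, hn⟩ := ENNReal.exists_nat_gt hx.ne
      exact Set.mem_iUnion.2 ⟨n, hn.le⟩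
    have h3 := measure_eq_zero_iff_ae_notMem.mp h1
    have : ∀ᵐ x ∂ν, False := by
      filter_upwards [h2, h3] with x a b using b a
    simpa [ae_iff] using this
  obtain ⟨n, hn⟩ := key
  have hms : MeasurableSet {x | μ.rnDeriv ν x ≤ n} :=
    measurableSet_le (Measure.measurable_rnDeriv μ ν) measurable_const
  have hc := aeconst_of_forall_preimage_smul_ae_eq (μ := ν) G hms.nullMeasurableSet (by
    intro g
    filter_upwards [hh g] with x hx
    change (μ.rnDeriv ν (g • x) ≤ n) = (μ.rnDeriv ν x ≤ n)
    rw [hx])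
  rw [Filter.eventuallyConst_set] at hc
  have hle : ∀ᵐ x ∂ν, μ.rnDeriv ν x ≤ n := by
    rcases hc with hc | hc
    · exact hc
    · exact absurd (measure_eq_zero_iff_ae_notMem.mpr (by
        filter_upwards [hc] with x hx using by simpa using hx)) hn
  refine ⟨n, ?_⟩
  rw [← Measure.withDensity_rnDeriv_eq μ ν hac]
  calc ν.withDensity (μ.rnDeriv ν) ≤ ν.withDensity (fun _ => (n : ENNReal)) :=
        withDensity_mono hle
    _ = (n : NNReal) • ν := by
        rw [withDensity_const]; ext s; simp

lemma aux_compact {Z : Type*} [TopologicalSpace Z] [CompactSpace Z] [MeasurableSpace Z]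
    (μ ν : Measure Z)
    (h : ∀ z : Z, ∃ U : Set Z, IsOpen U ∧ z ∈ U ∧ ∃ C : NNReal, μ.restrict U ≤ C • ν) :
    ∃ C : NNReal, μ ≤ C • ν := by
  have := isCompact_univ.induction_on (X := Z)
    (p := fun s => ∃ C : NNReal, μ.restrict s ≤ C • ν)
    ⟨0, by simp⟩
    (fun s t hst ⟨C, hC⟩ => ⟨C, (Measure.restrict_mono hst le_rfl).trans hC⟩)
    (fun s t ⟨C, hC⟩ ⟨C', hC'⟩ => ⟨C + C', by
      rw [add_smul]
      exact (Measure.restrict_union_le s t).trans (add_le_add hC hC')⟩)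
    (fun z _ => by
      obtain ⟨U, hU, hz, C, hC⟩ := h z
      exact ⟨U, mem_nhdsWithin_of_mem_nhds (hU.mem_nhds hz), C, hC⟩)
  simpa using this

lemma aux_rn {Z : Type*} [MeasurableSpace Z] (ν κ : Measure Z)
    [IsProbabilityMeasure ν] [IsProbabilityMeasure κ] (hac : ν ≪ κ)
    (h1 : ∃ C : NNReal, ν ≤ C • κ) (h2 : ∃ C : NNReal, κ ≤ C • ν) :
    ∃ C : ℝ, 1 ≤ C ∧ ∀ᵐ z ∂κ, C⁻¹ ≤ (ν.rnDeriv κ z).toReal ∧ (ν.rnDeriv κ z).toReal ≤ C := by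
  obtain ⟨a, ha⟩ := h1
  obtain ⟨b, hb⟩ := h2
  have hf := Measure.measurable_rnDeriv ν κ
  have up : ∀ᵐ z ∂κ, ν.rnDeriv κ z ≤ a := by
    refine ae_le_of_forall_setLIntegral_le_of_sigmaFinite hf (fun s hs _ => ?_)
    rw [Measure.setLIntegral_rnDeriv hac]
    simpa using ha s
  have lo : ∀ᵐ z ∂κ, 1 ≤ (b : ENNReal) * ν.rnDeriv κ z := by
    refine ae_le_of_forall_setLIntegral_le_of_sigmaFinite measurable_const (fun s hs _ => ?_)
    rw [lintegral_const_mul _ hf, Measure.setLIntegral_rnDeriv hac]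
    simpa using hb s
  refine ⟨max 1 (max a b), le_max_left _ _, ?_⟩
  filter_upwards [up, lo, Measure.rnDeriv_lt_top ν κ] with z hu hl ht
  have hl' : (1 : ℝ) ≤ b * (ν.rnDeriv κ z).toReal := by
    have := ENNReal.toReal_mono (ENNReal.mul_ne_top ENNReal.coe_ne_top ht.ne) hl
    simpa using this
  have hu' : (ν.rnDeriv κ z).toReal ≤ a := by
    have := ENNReal.toReal_mono ENNReal.coe_ne_top hu
    simpa using this
  have hpos : 0 ≤ (ν.rnDeriv κ z).toReal := ENNReal.toReal_nonneg
  have hC : (0:ℝ) < max 1 (max (a:ℝ) b) := lt_of_lt_of_le one_pos (le_max_left _ _)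
  refine ⟨?_, hu'.trans ((le_max_left _ _).trans (le_max_right _ _))⟩
  rw [inv_le_iff_one_le_mul₀' hC]
  exact hl'.trans (mul_le_mul_of_nonneg_right ((le_max_right _ _).trans (le_max_right _ _)) hpos)

lemma aux_local {Z : Type*} [TopologicalSpace Z] [CompactSpace Z]
    [TopologicalSpace.MetrizableSpace Z] [MeasurableSpace Z] [BorelSpace Z]
    (ν₁ ν₂ κ₁ κ₂ : Measure Z)
    [IsProbabilityMeasure ν₁] [IsProbabilityMeasure ν₂]
    [IsProbabilityMeasure κ₁] [IsProbabilityMeasure κ₂]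
    (D : Set (Z × Z)) (hD : D = {p : Z × Z | p.1 ≠ p.2}) (hDm : MeasurableSet D)
    (f k : Z × Z → ℝ) (ε : ℝ) (hε : 0 < ε) (hf : ∀ p ∈ D, ε ≤ f p)
    (hbdd : ∀ K : Set (Z × Z), K ⊆ D → IsCompact K → ∃ M : ℝ, ∀ p ∈ K, k p ≤ M)
    (c : NNReal)
    (hc : ((ν₁.prod ν₂).restrict D).withDensity (fun p => ENNReal.ofReal (f p)) ≤
      c • ((κ₁.prod κ₂).restrict D).withDensity (fun p => ENNReal.ofReal (k p)))
    (x y : Z) (hxy : x ≠ y) :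
    ∃ U V : Set Z, IsOpen U ∧ IsOpen V ∧ x ∈ U ∧ y ∈ V ∧ ∃ C : NNReal,
      ∀ A B : Set Z, MeasurableSet A → MeasurableSet B → A ⊆ U → B ⊆ V →
        ν₁ A * ν₂ B ≤ C * (κ₁ A * κ₂ B) := by
  obtain ⟨U, hxU, hU, V, hyV, hV, hd⟩ := exists_open_nhds_disjoint_closure hxy
  refine ⟨U, V, hU, hV, hxU, hyV, ?_⟩
  have hKD : closure U ×ˢ closure V ⊆ D := by
    rintro ⟨a, b⟩ ⟨ha, hb⟩
    rw [hD]
    rintro (rfl : a = b)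
    exact Set.disjoint_left.1 hd ha hb
  obtain ⟨M, hM⟩ := hbdd _ hKD (isClosed_closure.isCompact.prod isClosed_closure.isCompact)
  refine ⟨(Real.toNNReal ε)⁻¹ * (c * Real.toNNReal M), ?_⟩
  intro A B hA hB hAU hBV
  have hABK : A ×ˢ B ⊆ closure U ×ˢ closure V :=
    Set.prod_mono (hAU.trans subset_closure) (hBV.trans subset_closure)
  have hABD := hABK.trans hKD
  have hAB : MeasurableSet (A ×ˢ B) := hA.prod hB
  have h := hc (A ×ˢ B)
  rw [Measure.smul_apply, withDensity_apply _ hAB, withDensity_apply _ hAB,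
    Measure.restrict_restrict hAB, Measure.restrict_restrict hAB,
    Set.inter_eq_left.2 hABD] at h
  have h1 : ENNReal.ofReal ε * (ν₁ A * ν₂ B) ≤
      ∫⁻ p in A ×ˢ B, ENNReal.ofReal (f p) ∂(ν₁.prod ν₂) := by
    rw [← Measure.prod_prod, ← setLIntegral_const]
    exact setLIntegral_mono' hAB (fun p hp => ENNReal.ofReal_le_ofReal (hf p (hABD hp)))
  have h2 : ∫⁻ p in A ×ˢ B, ENNReal.ofReal (k p) ∂(κ₁.prod κ₂) ≤
      ENNReal.ofReal M * (κ₁ A * κ₂ B) := by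
    rw [← Measure.prod_prod, ← setLIntegral_const]
    exact setLIntegral_mono' hAB (fun p hp => ENNReal.ofReal_le_ofReal (hM p (hABK hp)))
  have h3 : ENNReal.ofReal ε * (ν₁ A * ν₂ B) ≤ c * (ENNReal.ofReal M * (κ₁ A * κ₂ B)) := by
    refine h1.trans (h.trans ?_)
    rw [ENNReal.smul_def, smul_eq_mul]
    gcongr
  have hε0 : Real.toNNReal ε ≠ 0 := by simpa using hε
  have e : ν₁ A * ν₂ B = ((Real.toNNReal ε)⁻¹ : NNReal) * (ENNReal.ofReal ε * (ν₁ A * ν₂ B)) := by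
    rw [← mul_assoc, ENNReal.ofReal, ← ENNReal.coe_mul, inv_mul_cancel₀ hε0]; simp
  rw [e]
  push_cast
  rw [mul_assoc, mul_assoc]
  exact mul_le_mul_right h3 _

lemma aux_half {Z : Type*} [TopologicalSpace Z] [CompactSpace Z]
    [TopologicalSpace.MetrizableSpace Z] [Nontrivial Z] [MeasurableSpace Z] [BorelSpace Z]
    (ν₁ ν₂ κ₁ κ₂ : Measure Z)
    [IsProbabilityMeasure ν₁] [IsProbabilityMeasure ν₂]
    [IsProbabilityMeasure κ₁] [IsProbabilityMeasure κ₂]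
    (hfull : ∀ U : Set Z, IsOpen U → U.Nonempty → 0 < ν₂ U)
    (hloc : ∀ x y : Z, x ≠ y → ∃ U V : Set Z, IsOpen U ∧ IsOpen V ∧ x ∈ U ∧ y ∈ V ∧
      ∃ C : NNReal, ∀ A B : Set Z, MeasurableSet A → MeasurableSet B → A ⊆ U → B ⊆ V →
        ν₁ A * ν₂ B ≤ C * (κ₁ A * κ₂ B)) :
    ∃ C : NNReal, ν₁ ≤ C • κ₁ := by
  apply aux_compact
  intro x
  obtain ⟨y, hy⟩ := exists_ne x
  obtain ⟨U, V, hU, hV, hx, hyV, C, hC⟩ := hloc x y hy.symm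
  have hv : ν₂ V ≠ 0 := (hfull V hV ⟨y, hyV⟩).ne'
  have hvt : ν₂ V ≠ ⊤ := measure_ne_top _ _
  refine ⟨U, hU, hx, C * (ν₂ V).toNNReal⁻¹, ?_⟩
  refine Measure.le_iff.2 fun s hs => ?_
  rw [Measure.restrict_apply hs, Measure.smul_apply, ENNReal.smul_def, smul_eq_mul]
  have h := hC (s ∩ U) V (hs.inter hU.measurableSet) hV.measurableSet Set.inter_subset_right
    subset_rfl
  have h' : ν₁ (s ∩ U) * ν₂ V ≤ C * κ₁ s := by
    refine h.trans ?_
    gcongr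
    calc κ₁ (s ∩ U) * κ₂ V ≤ κ₁ s * 1 := by
          gcongr
          · exact Set.inter_subset_left
          · exact prob_le_one
      _ = κ₁ s := mul_one _
  have hv' : (ν₂ V).toNNReal ≠ 0 := by
    simp [ENNReal.toNNReal_eq_zero_iff, hv, hvt]
  rw [ENNReal.coe_mul, ENNReal.coe_inv hv', ENNReal.coe_toNNReal hvt, mul_right_comm,
    ← div_eq_mul_inv, ENNReal.le_div_iff_mul_le (Or.inl hv) (Or.inl hvt)]
  exact h'

lemma aux_ac {X : Type*} [MeasurableSpace X] (μ ν : Measure X) (D : Set X) (hD : MeasurableSet D)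
    (hμν : μ ≪ ν) (f k : X → ℝ) (hk : Measurable k) (hpos : ∀ p ∈ D, 0 < k p) :
    (μ.restrict D).withDensity (fun p => ENNReal.ofReal (f p)) ≪
      (ν.restrict D).withDensity (fun p => ENNReal.ofReal (k p)) := by
  refine (withDensity_absolutelyContinuous _ _).trans ((hμν.restrict D).trans ?_)
  refine withDensity_absolutelyContinuous' hk.ennreal_ofReal.aemeasurable ?_
  filter_upwards [ae_restrict_mem hD] with p hp
  simpa using hpos p hp

lemma aux_sf {X : Type*} [MeasurableSpace X] (μ : Measure X) [SigmaFinite μ] (f : X → ℝ)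
    (hf : Measurable f) : SigmaFinite (μ.withDensity (fun p => ENNReal.ofReal (f p))) := by
  exact SigmaFinite.withDensity_ofReal f

/-- **Bounded Radon–Nikodym derivatives from invariant ergodic densities on the
square minus the diagonal.**
Let a countable group `G` act by homeomorphisms on a compact metrizable space `Z`
with at least two points. Let `ν₁, ν₂, κ₁, κ₂` be fully supported Borel probability
measures with `νᵢ` equivalent to `κᵢ`, whose measure classes are `G`-invariant, and
such that the diagonal `G`-action on `Z × Z` is ergodic for `ν₁ ⊗ ν₂` and `κ₁ ⊗ κ₂`.
If there are densities `f_ν, f_κ`, positive, bounded away from `0` and bounded on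
compact subsets of `(Z × Z) \ Diag`, making `f_ν·(ν₁ ⊗ ν₂)` and `f_κ·(κ₁ ⊗ κ₂)`
(restricted off the diagonal) `G`-invariant and ergodic, then each `dνᵢ/dκᵢ` is
bounded away from `0` and `∞`. -/
theorem rnDeriv_bounded_of_invariant_ergodic_densities
    {Z G : Type*} [TopologicalSpace Z] [CompactSpace Z]
    [TopologicalSpace.MetrizableSpace Z] [Nontrivial Z]
    [MeasurableSpace Z] [BorelSpace Z]
    [Group G] [Countable G] [MulAction G Z]
    (hcont : ∀ g : G, Continuous (fun z : Z => g • z))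
    (ν₁ ν₂ κ₁ κ₂ : Measure Z)
    [IsProbabilityMeasure ν₁] [IsProbabilityMeasure ν₂]
    [IsProbabilityMeasure κ₁] [IsProbabilityMeasure κ₂]
    (hfull : ∀ m ∈ [ν₁, ν₂, κ₁, κ₂], ∀ U : Set Z, IsOpen U → U.Nonempty → 0 < m U)
    (hequiv₁ : ν₁ ≪ κ₁ ∧ κ₁ ≪ ν₁) (hequiv₂ : ν₂ ≪ κ₂ ∧ κ₂ ≪ ν₂)
    (hclass : ∀ m ∈ [ν₁, ν₂, κ₁, κ₂], ∀ g : G,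
      Measure.map (fun z : Z => g • z) m ≪ m ∧ m ≪ Measure.map (fun z : Z => g • z) m)
    (hergν : ∀ A : Set (Z × Z), MeasurableSet A →
      (∀ g : G, (fun p : Z × Z => (g • p.1, g • p.2)) ⁻¹' A = A) →
      (ν₁.prod ν₂) A = 0 ∨ (ν₁.prod ν₂) Aᶜ = 0)
    (hergκ : ∀ A : Set (Z × Z), MeasurableSet A →
      (∀ g : G, (fun p : Z × Z => (g • p.1, g • p.2)) ⁻¹' A = A) →
      (κ₁.prod κ₂) A = 0 ∨ (κ₁.prod κ₂) Aᶜ = 0)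
    (D : Set (Z × Z)) (hD : D = {p : Z × Z | p.1 ≠ p.2})
    (fν fκ : Z × Z → ℝ)
    (hmeasν : Measurable fν) (hmeasκ : Measurable fκ)
    (hposν : ∀ p ∈ D, 0 < fν p) (hposκ : ∀ p ∈ D, 0 < fκ p)
    (hbelow : ∃ ε : ℝ, 0 < ε ∧ (∀ p ∈ D, ε ≤ fν p) ∧ (∀ p ∈ D, ε ≤ fκ p))
    (hbdd : ∀ K : Set (Z × Z), K ⊆ D → IsCompact K →
      ∃ M : ℝ, (∀ p ∈ K, fν p ≤ M) ∧ (∀ p ∈ K, fκ p ≤ M))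
    (mν mκ : Measure (Z × Z))
    (hmν : mν = ((ν₁.prod ν₂).restrict D).withDensity (fun p => ENNReal.ofReal (fν p)))
    (hmκ : mκ = ((κ₁.prod κ₂).restrict D).withDensity (fun p => ENNReal.ofReal (fκ p)))
    (hinv : ∀ g : G,
      Measure.map (fun p : Z × Z => (g • p.1, g • p.2)) mν = mν ∧
      Measure.map (fun p : Z × Z => (g • p.1, g • p.2)) mκ = mκ)
    (hergm : ∀ A : Set (Z × Z), A ⊆ D → MeasurableSet A →
      (∀ g : G, (fun p : Z × Z => (g • p.1, g • p.2)) ⁻¹' A = A) →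
      (mν A = 0 ∨ mν (D \ A) = 0) ∧ (mκ A = 0 ∨ mκ (D \ A) = 0)) :
    (∃ C : ℝ, 1 ≤ C ∧
      ∀ᵐ z ∂κ₁, C⁻¹ ≤ (ν₁.rnDeriv κ₁ z).toReal ∧ (ν₁.rnDeriv κ₁ z).toReal ≤ C) ∧
    (∃ C : ℝ, 1 ≤ C ∧
      ∀ᵐ z ∂κ₂, C⁻¹ ≤ (ν₂.rnDeriv κ₂ z).toReal ∧ (ν₂.rnDeriv κ₂ z).toReal ≤ C) := by
  let _ := TopologicalSpace.metrizableSpaceMetric Z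
  have hDo : IsOpen D := by
    rw [hD]; exact isOpen_ne_fun continuous_fst continuous_snd
  have hDm : MeasurableSet D := hDo.measurableSet
  obtain ⟨ε, hε, hεν, hεκ⟩ := hbelow
  obtain ⟨x, y, hxy⟩ := exists_pair_ne Z
  have ne0 : ∀ (μ₁ μ₂ : Measure Z) [IsProbabilityMeasure μ₁] [IsProbabilityMeasure μ₂]
      (f : Z × Z → ℝ), Measurable f → (∀ p ∈ D, 0 < f p) →
      (∀ U : Set Z, IsOpen U → U.Nonempty → 0 < μ₁ U) →
      (∀ U : Set Z, IsOpen U → U.Nonempty → 0 < μ₂ U) →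
      ((μ₁.prod μ₂).restrict D).withDensity (fun p => ENNReal.ofReal (f p)) ≠ 0 := by
    intro μ₁ μ₂ _ _ f hf hpos h1 h2 h0
    have hac := aux_ac (μ₁.prod μ₂) (μ₁.prod μ₂) D hDm Measure.AbsolutelyContinuous.rfl
      (fun _ => 1) f hf hpos
    rw [h0] at hac
    have hz := hac (s := D) (by simp)
    simp only [ENNReal.ofReal_one] at hz
    rw [withDensity_const, one_smul, Measure.restrict_apply_self] at hz
    obtain ⟨U, V, hU, hV, hxU, hyV, hd⟩ := t2_separation hxy
    have hsub : U ×ˢ V ⊆ D := by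
      rintro ⟨a, b⟩ ⟨ha, hb⟩
      rw [hD]
      rintro (rfl : a = b)
      exact Set.disjoint_left.1 hd ha hb
    have h3 := measure_mono_null hsub hz
    rw [Measure.prod_prod] at h3
    exact (mul_ne_zero (h1 U hU ⟨x, hxU⟩).ne' (h2 V hV ⟨y, hyV⟩).ne') h3
  have hDinv : ∀ g : G, (fun p : Z × Z => (g • p.1, g • p.2)) ⁻¹' D = D := by
    intro g; rw [hD]; ext p; simp
  have hgm : ∀ g : G, Measurable (fun p : Z × Z => g • p) := fun g =>
    (((hcont g).comp continuous_fst).prodMk ((hcont g).comp continuous_snd)).measurable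
  have fν₁ := hfull ν₁ (by simp)
  have fν₂ := hfull ν₂ (by simp)
  have fκ₁ := hfull κ₁ (by simp)
  have fκ₂ := hfull κ₂ (by simp)
  have nν : mν ≠ 0 := hmν ▸ ne0 ν₁ ν₂ fν hmeasν hposν fν₁ fν₂
  have nκ : mκ ≠ 0 := hmκ ▸ ne0 κ₁ κ₂ fκ hmeasκ hposκ fκ₁ fκ₂
  have sν : SigmaFinite mν := by
    rw [hmν]; exact aux_sf _ fν hmeasν
  have sκ : SigmaFinite mκ := by
    rw [hmκ]; exact aux_sf _ fκ hmeasκ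
  have acνκ : mν ≪ mκ := by
    rw [hmν, hmκ]
    exact aux_ac _ _ D hDm (hequiv₁.1.prod hequiv₂.1) _ _ hmeasκ hposκ
  have acκν : mκ ≪ mν := by
    rw [hmν, hmκ]
    exact aux_ac _ _ D hDm (hequiv₁.2.prod hequiv₂.2) _ _ hmeasν hposν
  have zν : mν Dᶜ = 0 := by
    rw [hmν]
    exact withDensity_absolutelyContinuous _ _ (by
      rw [Measure.restrict_apply hDm.compl]; simp)
  have zκ : mκ Dᶜ = 0 := acκν zν
  have herg : ∀ A : Set (Z × Z), MeasurableSet A →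
      (∀ g : G, (fun p : Z × Z => g • p) ⁻¹' A = A) →
      (mν A = 0 ∨ mν Aᶜ = 0) ∧ (mκ A = 0 ∨ mκ Aᶜ = 0) := by
    intro A hA hg
    have h := hergm (A ∩ D) Set.inter_subset_right (hA.inter hDm) (by
      intro g
      rw [Set.preimage_inter, hDinv g]
      congr 1
      exact hg g)
    have s1 : A ⊆ (A ∩ D) ∪ Dᶜ := by
      intro p hp; by_cases hpD : p ∈ D
      · exact Or.inl ⟨hp, hpD⟩
      · exact Or.inr hpD
    have s2 : Aᶜ ⊆ (D \ (A ∩ D)) ∪ Dᶜ := by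
      intro p hp; by_cases hpD : p ∈ D
      · exact Or.inl ⟨hpD, fun h => hp h.1⟩
      · exact Or.inr hpD
    exact ⟨h.1.imp (fun h => measure_mono_null s1 (measure_union_null h zν))
        (fun h => measure_mono_null s2 (measure_union_null h zν)),
      h.2.imp (fun h => measure_mono_null s1 (measure_union_null h zκ))
        (fun h => measure_mono_null s2 (measure_union_null h zκ))⟩
  obtain ⟨c, hc⟩ := aux_ergodic_le hgm mν mκ acνκ nκ (fun g => (hinv g).1) (fun g => (hinv g).2)
    (fun A hA hg => (herg A hA hg).2)
  obtain ⟨d, hd⟩ := aux_ergodic_le hgm mκ mν acκν nν (fun g => (hinv g).2) (fun g => (hinv g).1)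
    (fun A hA hg => (herg A hA hg).1)
  rw [hmν, hmκ] at hc hd
  have L1 := aux_local ν₁ ν₂ κ₁ κ₂ D hD hDm fν fκ ε hε hεν
    (fun K hK hK' => (hbdd K hK hK').imp fun M h => h.2) c hc
  have L2 := aux_local κ₁ κ₂ ν₁ ν₂ D hD hDm fκ fν ε hε hεκ
    (fun K hK hK' => (hbdd K hK hK').imp fun M h => h.1) d hd
  have flip : ∀ (a b a' b' : Measure Z),
      (∀ x y : Z, x ≠ y → ∃ U V : Set Z, IsOpen U ∧ IsOpen V ∧ x ∈ U ∧ y ∈ V ∧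
      ∃ C : NNReal, ∀ A B : Set Z, MeasurableSet A → MeasurableSet B → A ⊆ U → B ⊆ V →
        a A * b B ≤ C * (a' A * b' B)) →
      (∀ x y : Z, x ≠ y → ∃ U V : Set Z, IsOpen U ∧ IsOpen V ∧ x ∈ U ∧ y ∈ V ∧
      ∃ C : NNReal, ∀ A B : Set Z, MeasurableSet A → MeasurableSet B → A ⊆ U → B ⊆ V →
        b A * a B ≤ C * (b' A * a' B)) := by
    intro a b a' b' h x y hxy
    obtain ⟨U, V, hU, hV, hx, hy, C, hC⟩ := h y x hxy.symm
    refine ⟨V, U, hV, hU, hy, hx, C, fun A B hA hB hAV hBU => ?_⟩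
    rw [mul_comm (b A), mul_comm (b' A)]
    exact hC B A hB hA hBU hAV
  exact ⟨aux_rn ν₁ κ₁ hequiv₁.1 (aux_half ν₁ ν₂ κ₁ κ₂ fν₂ L1) (aux_half κ₁ κ₂ ν₁ ν₂ fκ₂ L2),
    aux_rn ν₂ κ₂ hequiv₂.1 (aux_half ν₂ ν₁ κ₂ κ₁ fν₁ (flip _ _ _ _ L1))
      (aux_half κ₂ κ₁ ν₂ ν₁ fκ₁ (flip _ _ _ _ L2))⟩
end

section
/- Let G be a finitely generated nilpotent group that is not virtually cyclic. Then the free rank of the abelianization of G is at least 2; equivalently, there exists a surjective group homomorphism from G onto ℤ × ℤ. -/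
open Subgroup

/-- A homomorphism to `ℤ × ℤ` whose image contains all `n`-th multiples yields a surjection. -/
theorem aux_surj_of_pow {G : Type*} [Group G] (f : G →* Multiplicative (ℤ × ℤ)) (n : ℕ)
    (hn : n ≠ 0) (hf : ∀ v, ∃ g, f g = v ^ n) :
    ∃ f : G →* Multiplicative (ℤ × ℤ), Function.Surjective f := by
  let N : Submodule ℤ (ℤ × ℤ) := AddSubgroup.toIntSubmodule (Subgroup.toAddSubgroup' f.range)
  have hmem : ∀ v : ℤ × ℤ, v ∈ N ↔ ∃ g, f g = Multiplicative.ofAdd v := fun v => Iff.rfl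
  let m : (ℤ × ℤ) →ₗ[ℤ] N := LinearMap.codRestrict N ((n : ℤ) • LinearMap.id) (by
    intro v
    rw [hmem]
    obtain ⟨g, hg⟩ := hf (Multiplicative.ofAdd v)
    refine ⟨g, hg.trans ?_⟩
    simp [← ofAdd_nsmul])
  have hm : Function.Injective m := by
    intro v w h
    have h1 : (n : ℤ) • v = (n : ℤ) • w := congrArg Subtype.val h
    have hn' : (n : ℤ) ≠ 0 := by exact_mod_cast hn
    exact smul_right_injective _ hn' h1
  have h1 := LinearMap.finrank_le_finrank_of_injective hm
  have h2 := Submodule.finrank_le N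
  have h3 : Module.finrank ℤ N = Module.finrank ℤ (ℤ × ℤ) := le_antisymm h2 h1
  let e : N ≃ₗ[ℤ] (ℤ × ℤ) := LinearEquiv.ofFinrankEq _ _ h3
  let F : G →* Multiplicative N :=
    { toFun := fun g => Multiplicative.ofAdd ⟨(f g).toAdd, (hmem _).2 ⟨g, rfl⟩⟩
      map_one' := by
        apply Multiplicative.toAdd.injective
        apply Subtype.ext
        simp
      map_mul' := by
        intro a b
        apply Multiplicative.toAdd.injective
        apply Subtype.ext
        simp }
  refine ⟨(AddMonoidHom.toMultiplicative e.toAddMonoidHom).comp F, ?_⟩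
  intro v
  obtain ⟨w, hw⟩ := e.surjective v.toAdd
  obtain ⟨g, hg⟩ := (hmem _).1 w.2
  refine ⟨g, ?_⟩
  have : F g = Multiplicative.ofAdd w := by
    apply Multiplicative.toAdd.injective
    apply Subtype.ext
    change (f g).toAdd = _
    rw [hg]; rfl
  apply Multiplicative.toAdd.injective
  rw [← hw]
  change e (F g).toAdd = _
  rw [this]; rfl

/-- Dichotomy for finitely generated abelian groups. -/
theorem aux_comm (A : Type*) [CommGroup A] [Group.FG A] :
    (∃ f : A →* Multiplicative (ℤ × ℤ), Function.Surjective f) ∨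
      ∃ C : Subgroup A, C.FiniteIndex ∧ IsCyclic C := by
  obtain ⟨r, ι, _, p, hp, e, ⟨φ⟩⟩ := AddCommGroup.equiv_free_prod_directSum_zmod (Additive A)
  by_cases hr : 2 ≤ r
  · left
    let i0 : Fin r := ⟨0, by omega⟩
    let i1 : Fin r := ⟨1, by omega⟩
    have h01 : i0 ≠ i1 := by simp [i0, i1]
    let π : (Fin r →₀ ℤ) →+ ℤ × ℤ :=
      (Finsupp.applyAddHom i0).prod (Finsupp.applyAddHom i1)
    let F : Additive A →+ ℤ × ℤ := π.comp ((AddMonoidHom.fst _ _).comp φ.toAddMonoidHom)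
    refine ⟨AddMonoidHom.toMultiplicativeRight F, ?_⟩
    intro v
    let w := φ.symm (Finsupp.single i0 v.toAdd.1 + Finsupp.single i1 v.toAdd.2, 0)
    refine ⟨w.toMul, ?_⟩
    change Multiplicative.ofAdd (F w) = v
    apply Multiplicative.toAdd.injective
    change F w = v.toAdd
    have : F w = π (φ w).1 := rfl
    rw [this, φ.apply_symm_apply]
    ext <;> simp [π, h01, h01.symm]
  · right
    have hfin : ∀ i, Finite (ZMod (p i ^ e i)) := fun i =>
      haveI : NeZero (p i ^ e i) := ⟨pow_ne_zero _ (hp i).ne_zero⟩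
      inferInstance
    have : Finite (DirectSum ι fun i => ZMod (p i ^ e i)) :=
      Finite.of_equiv _ DFinsupp.equivFunOnFintype.symm
    let T : A →* Multiplicative (DirectSum ι fun i => ZMod (p i ^ e i)) :=
      AddMonoidHom.toMultiplicativeRight ((AddMonoidHom.snd _ _).comp φ.toAddMonoidHom)
    let σ : (Fin r →₀ ℤ) →+ ℤ := Finsupp.liftAddHom fun _ => AddMonoidHom.id ℤ
    have hσ : ∀ x, σ x = 0 → x = 0 := by
      intro x hx
      have hx' : ∑ i, x i = 0 := by
        rw [← hx]
        simp [σ, Finsupp.sum_fintype]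
      ext i
      have : Subsingleton (Fin r) := Fin.subsingleton_iff_le_one.2 (by omega)
      rw [Fintype.sum_subsingleton _ i] at hx'
      simpa using hx'
    let S : A →* Multiplicative ℤ :=
      AddMonoidHom.toMultiplicativeRight (σ.comp ((AddMonoidHom.fst _ _).comp φ.toAddMonoidHom))
    refine ⟨T.ker, inferInstance, ?_⟩
    refine isCyclic_of_injective (S.comp T.ker.subtype) ?_
    rw [injective_iff_map_eq_one]
    rintro ⟨a, ha⟩ h
    have h1 : (φ (Additive.ofMul a)).2 = 0 := ha
    have h2 : σ (φ (Additive.ofMul a)).1 = 0 := h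
    have h3 : φ (Additive.ofMul a) = 0 := Prod.ext (hσ _ h2) h1
    have h4 : Additive.ofMul a = 0 := by simpa using h3
    apply Subtype.ext
    exact h4

/-- If `G / Z(G)` has a central cyclic subgroup of finite index, then `Z(G)` has finite index. -/
theorem aux_center (G : Type*) [Group G] (C : Subgroup (G ⧸ center G)) (hC : C ≤ center _)
    [hfi : C.FiniteIndex] [hcyc : IsCyclic C] : (center G).FiniteIndex := by
  obtain ⟨⟨q, hqC⟩, hq⟩ := hcyc.exists_generator
  obtain ⟨x, rfl⟩ := QuotientGroup.mk_surjective q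
  have hCn : C.Normal := by
    constructor
    intro c hc g
    have := mem_center_iff.1 (hC hc) g
    rw [this]; simpa using hc
  have hcent : ∀ z ∈ center G, ∀ g, Commute g z := fun z hz g => mem_center_iff.1 hz g
  -- `x` commutes with everything mapping into `C`
  have hcomm : ∀ h : G, (h : G ⧸ center G) ∈ C → Commute h x := by
    intro h hh
    obtain ⟨k, hk⟩ := mem_zpowers_iff.1 (hq ⟨h, hh⟩)
    have hk' : ((x ^ k : G) : G ⧸ center G) = h := by
      have := congrArg Subtype.val hk
      simpa using this
    have hz := hcent _ (QuotientGroup.eq.1 hk') x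
    have : h = x ^ k * ((x ^ k)⁻¹ * h) := by group
    rw [this]
    exact Commute.mul_left ((Commute.refl x).zpow_left k) hz.symm
  set n := C.index with hn
  have hn0 : n ≠ 0 := hfi.index_ne_zero
  have hxn : x ^ n ∈ center G := by
    rw [mem_center_iff]
    intro g
    have hz : x⁻¹ * (g * x * g⁻¹) ∈ center G := by
      rw [← QuotientGroup.eq]
      have := mem_center_iff.1 (hC hqC) (g : G ⧸ center G)
      rw [QuotientGroup.mk_mul, QuotientGroup.mk_mul, this, QuotientGroup.mk_inv]
      simp
    set z := x⁻¹ * (g * x * g⁻¹) with hzdef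
    have h1 : g * x * g⁻¹ = x * z := by rw [hzdef]; group
    have h2 : ∀ k : ℕ, g ^ k * x * (g ^ k)⁻¹ = x * z ^ k := by
      intro k
      induction k with
      | zero => simp
      | succ k ih =>
        have : g ^ (k+1) * x * (g ^ (k+1))⁻¹ = g * (g ^ k * x * (g ^ k)⁻¹) * g⁻¹ := by
          rw [pow_succ']; group
        rw [this, ih]
        have hk := (hcent _ (Subgroup.pow_mem _ hz k) g⁻¹).eq
        calc g * (x * z ^ k) * g⁻¹ = g * x * (z ^ k * g⁻¹) := by group
          _ = (g * x * g⁻¹) * z ^ k := by rw [← hk]; group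
          _ = x * z ^ (k+1) := by rw [h1, pow_succ']; group
    have h3 : z ^ n = 1 := by
      have hgn : Commute (g ^ n) x := hcomm _ (by
        rw [QuotientGroup.mk_pow]
        exact C.pow_index_mem _)
      have := h2 n
      rw [hgn.eq] at this
      simpa using this
    have h4 : g * x ^ n * g⁻¹ = x ^ n := by
      rw [← conj_pow, h1, (hcent _ hz x).mul_pow, h3, mul_one]
    rwa [mul_inv_eq_iff_eq_mul] at h4
  have hfinC : Finite C := by
    have : IsOfFinOrder (⟨(x : G ⧸ center G), hqC⟩ : C) := by
      rw [isOfFinOrder_iff_pow_eq_one]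
      refine ⟨n, Nat.pos_of_ne_zero hn0, Subtype.ext ?_⟩
      change ((x : G ⧸ center G)) ^ n = 1
      rw [← QuotientGroup.mk_pow]
      exact (QuotientGroup.eq_one_iff _).2 hxn
    have hf : Finite (zpowers (⟨(x : G ⧸ center G), hqC⟩ : C)) := finite_zpowers.2 this
    exact Set.finite_univ_iff.1 (Set.Finite.subset (Set.toFinite _) fun y _ => hq y)
  have : Finite (G ⧸ center G) := by
    have h := C.card_mul_index
    refine Nat.finite_of_card_ne_zero ?_
    rw [← h]
    exact mul_ne_zero Nat.card_pos.ne' hn0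
  exact finiteIndex_of_finite_quotient

theorem aux_main {G : Type*} [Group G] [Group.IsNilpotent G] : Group.FG G →
    (¬ ∃ f : G →* Multiplicative (ℤ × ℤ), Function.Surjective f) →
    ∃ C : Subgroup G, C ≤ center G ∧ C.FiniteIndex ∧ IsCyclic C := by
  refine Group.nilpotent_center_quotient_ind
    (P := fun G [Group G] [Group.IsNilpotent G] => Group.FG G →
      (¬ ∃ f : G →* Multiplicative (ℤ × ℤ), Function.Surjective f) →
      ∃ C : Subgroup G, C ≤ center G ∧ C.FiniteIndex ∧ IsCyclic C) G ?_ ?_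
  · intro G _ _ _ _
    exact ⟨⊥, bot_le, inferInstance, inferInstance⟩
  · intro G _ _ ih hFG hG
    obtain ⟨C, hC, hfi, hcyc⟩ := ih inferInstance (by
      rintro ⟨f, hf⟩
      exact hG ⟨f.comp (QuotientGroup.mk' _), hf.comp (QuotientGroup.mk'_surjective _)⟩)
    have hZ := aux_center G C hC
    letI : CommGroup (center G) := { (inferInstance : Group (center G)) with
      mul_comm := fun a b => Subtype.ext (mem_center_iff.1 b.2 a) }
    rcases aux_comm (center G) with ⟨f, hf⟩ | ⟨D, hD, hDc⟩
    · exfalso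
      refine hG (aux_surj_of_pow (f.comp (MonoidHom.transferCenterPow G)) (center G).index
        hZ.index_ne_zero ?_)
      intro v
      obtain ⟨z, rfl⟩ := hf v
      refine ⟨z, ?_⟩
      rw [← map_pow]
      rfl
    · refine ⟨D.map (center G).subtype, map_subtype_le D, ⟨?_⟩, ?_⟩
      · rw [index_map_subtype]
        exact mul_ne_zero hD.index_ne_zero hZ.index_ne_zero
      · exact isCyclic_of_surjective
          (D.equivMapOfInjective _ (center G).subtype_injective).toMonoidHom
          (MulEquiv.surjective _)

/-- A finitely generated nilpotent group that is not virtually cyclic surjects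
onto `ℤ × ℤ`; equivalently, its abelianization has free rank at least 2. -/
theorem surjective_hom_to_int_prod_int_of_not_virtually_cyclic
    {G : Type*} [Group G] [Group.FG G] [Group.IsNilpotent G]
    (hnvc : ¬ ∃ H : Subgroup G, H.FiniteIndex ∧ IsCyclic H) :
    ∃ f : G →* Multiplicative (ℤ × ℤ), Function.Surjective f := by
  by_contra h
  obtain ⟨C, -, h1, h2⟩ := aux_main inferInstance h
  exact hnvc ⟨C, h1, h2⟩
end

section
/- Let (Ω, P) be a probability space and let φ : Ω → ℝ be an almost everywhere positive random variable such that both φ and log φ are integrable. Let 0 < β ≤ e^{−1} and suppose P(φ ≥ β) ≤ β. Then E[log φ] ≤ (1−β)·log β + β·log(1/β) + β·max(0, log E[φ]). -/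
open MeasureTheory

/-- **Quantitative Jensen-type estimate.** If `φ > 0` a.s., `φ` and `log φ` are
integrable, `0 < β ≤ e⁻¹` and `P(φ ≥ β) ≤ β`, then
`E[log φ] ≤ (1-β)·log β + β·log(1/β) + β·max(0, log E[φ])`. -/
theorem integral_log_le_of_small_tail
    {Ω : Type*} [MeasurableSpace Ω] (P : Measure Ω) [IsProbabilityMeasure P]
    (φ : Ω → ℝ) (hpos : ∀ᵐ ω ∂P, 0 < φ ω)
    (hφ : Integrable φ P) (hlog : Integrable (fun ω => Real.log (φ ω)) P)
    (β : ℝ) (hβ : 0 < β) (hβe : β ≤ Real.exp (-1))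
    (hPβ : (P {ω | β ≤ φ ω}).toReal ≤ β) :
    ∫ ω, Real.log (φ ω) ∂P ≤
      (1 - β) * Real.log β + β * Real.log (1 / β) +
        β * max 0 (Real.log (∫ ω, φ ω ∂P)) := by
  set L := max 0 (Real.log (∫ ω, φ ω ∂P)) with hL
  have hL0 : 0 ≤ L := le_max_left _ _
  have hl : Real.log β ≤ -1 := by
    have := Real.log_le_log hβ hβe
    rwa [Real.log_exp] at this
  have hE : ∫ ω, φ ω ∂P ≤ Real.exp L :=
    (Real.le_exp_log _).trans (Real.exp_le_exp.mpr (le_max_right _ _))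
  set A : Set Ω := {ω | β ≤ φ ω} with hA
  have hAm : NullMeasurableSet A P :=
    nullMeasurableSet_le aemeasurable_const hφ.aemeasurable
  set K : ℝ := -1 + L - 2 * Real.log β with hK
  have hInd : Integrable (A.indicator (fun _ => K)) P :=
    (integrable_const K).indicator₀ hAm
  have hIval : ∫ ω, A.indicator (fun _ => K) ω ∂P = (P A).toReal * K := by
    rw [integral_indicator₀ hAm, setIntegral_const]
    simp [Measure.real]
  have hlin : Integrable (fun ω => β / Real.exp L * φ ω) P := hφ.const_mul _
  have hadd : Integrable (fun ω => Real.log β + β / Real.exp L * φ ω) P :=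
    (integrable_const (Real.log β)).add hlin
  have hpt : ∀ᵐ ω ∂P, Real.log (φ ω) ≤
      (Real.log β + β / Real.exp L * φ ω) + A.indicator (fun _ => K) ω := by
    filter_upwards [hpos] with ω hω
    have hc : 0 < β / Real.exp L * φ ω := by positivity
    by_cases h : ω ∈ A
    · rw [Set.indicator_of_mem h]
      have h1 := Real.log_le_sub_one_of_pos hc
      rw [Real.log_mul (by positivity) hω.ne', Real.log_div hβ.ne' (by positivity),
        Real.log_exp] at h1
      linarith
    · rw [Set.indicator_of_notMem h]
      have h1 : φ ω < β := not_le.mp h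
      have h2 := Real.log_le_log hω h1.le
      linarith
  have hint := integral_mono_ae hlog (hadd.add hInd) hpt
  have hsum : ∫ ω, ((Real.log β + β / Real.exp L * φ ω) + A.indicator (fun _ => K) ω) ∂P
      = Real.log β + β / Real.exp L * (∫ ω, φ ω ∂P) + (P A).toReal * K := by
    rw [integral_add hadd hInd,
      integral_add (integrable_const _) hlin, integral_const_mul, hIval]
    simp
  have hint2 : ∫ ω, Real.log (φ ω) ∂P ≤
      Real.log β + β / Real.exp L * (∫ ω, φ ω ∂P) + (P A).toReal * K := hint.trans hsum.le
  have hb : β / Real.exp L * (∫ ω, φ ω ∂P) ≤ β := by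
    calc β / Real.exp L * (∫ ω, φ ω ∂P) ≤ β / Real.exp L * Real.exp L := by gcongr
      _ = β := by field_simp
  have hKp : (P A).toReal * K ≤ β * K :=
    mul_le_mul_of_nonneg_right hPβ (by linarith)
  rw [one_div, Real.log_inv]
  have : β * K = -β + β * L - 2 * (β * Real.log β) := by rw [hK]; ring
  linarith
end
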